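/- Let α, β, γ ∈ ℂ with Re β > −1 and with β, β+1, β+2 not nonpositive integers, and let ρ > 0 be a real number. Then ∫_{0}^{ρ} t^{β}·E(α;β;i/t)·E(α+γ;β;−i/t) dt = ρ^{β+1}·( β·f(α−1, β+1, γ+1, β; i/ρ) − i·ρ·f(α−1, β+2, γ+2, β; i/ρ) ), where for t > 0 and complex exponent w, t^w = exp(w·log t). -/

import Mathlib

open Complex

/-- MacRobert E-function with one upper and one lower parameter:
`E(a;b;z) = ∑ Γ(a+n)/(n!·Γ(b+n))·(−1/z)^n`. -/
noncomputable def macE1 (a b z : ℂ) : ℂ :=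
  ∑' n : ℕ, (Complex.Gamma (a + n) / ((n.factorial : ℂ) * Complex.Gamma (b + n))) * (-1 / z) ^ n

/-- MacRobert E-function with two upper and two lower parameters. -/
noncomputable def macE2 (a₁ a₂ b₁ b₂ z : ℂ) : ℂ :=
  ∑' n : ℕ, (Complex.Gamma (a₁ + n) * Complex.Gamma (a₂ + n) /
    ((n.factorial : ℂ) * Complex.Gamma (b₁ + n) * Complex.Gamma (b₂ + n))) * (-1 / z) ^ n

/-- `f(α,β,γ,δ;z) = ∑_{ν} z^{−ν}·Γ(α+γ+ν)/(ν!·Γ(β+ν)) · E(α+1, β+ν; δ, β+1+ν; z)`. -/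
noncomputable def fW (α β γ δ z : ℂ) : ℂ :=
  ∑' ν : ℕ, (z ^ (-(ν : ℤ)) * Complex.Gamma (α + γ + ν) /
    ((ν.factorial : ℂ) * Complex.Gamma (β + ν))) *
      macE2 (α + 1) (β + (ν : ℂ)) δ (β + 1 + (ν : ℂ)) z

/-- Pochhammer symbol `(a)_k = Γ(a+k)/Γ(a)`. -/
noncomputable def poch (a : ℂ) (k : ℕ) : ℂ := Complex.Gamma (a + k) / Complex.Gamma a

open MeasureTheory Filter Topology

lemma Gamma_ratio_succ (a b : ℂ) (n : ℕ) (ha : a + n ≠ 0) (hb : b + n ≠ 0) :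
    Gamma (a + (n + 1 : ℕ)) / (((n + 1).factorial : ℂ) * Gamma (b + (n + 1 : ℕ))) =
      (a + n) / (b + n) * (1 / ((n : ℂ) + 1)) *
        (Gamma (a + n) / ((n.factorial : ℂ) * Gamma (b + n))) := by
  have h1 : a + ((n + 1 : ℕ) : ℂ) = a + n + 1 := by push_cast; ring
  have h2 : b + ((n + 1 : ℕ) : ℂ) = b + n + 1 := by push_cast; ring
  rw [h1, h2, Gamma_add_one _ ha, Gamma_add_one _ hb, Nat.factorial_succ]
  push_cast
  simp only [div_eq_mul_inv, mul_inv]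
  ring

lemma eventually_add_natCast_ne_zero (a : ℂ) : ∀ᶠ n : ℕ in atTop, a + n ≠ 0 := by
  obtain ⟨N, hN⟩ := exists_nat_gt ‖a‖
  filter_upwards [eventually_ge_atTop N] with n hn h
  have h1 : a = -(n : ℂ) := eq_neg_of_add_eq_zero_left h
  have h2 : ‖a‖ = n := by rw [h1, norm_neg, norm_natCast]
  have h3 : (N : ℝ) ≤ n := by exact_mod_cast hn
  linarith

lemma summable_norm_Gamma_ratio (a b x : ℂ) :
    Summable fun n : ℕ => ‖Gamma (a + n) / ((n.factorial : ℂ) * Gamma (b + n)) * x ^ n‖ := by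
  have hlim : Tendsto (fun n : ℕ => ‖(a + n) / (b + n) * (1 / ((n : ℂ) + 1)) * x‖)
      atTop (𝓝 0) := by
    have h1 := tendsto_add_mul_div_add_mul_atTop_nhds (𝕜 := ℂ) a b 1 one_ne_zero
    have h2 := tendsto_one_div_add_atTop_nhds_zero_nat (𝕜 := ℂ)
    simpa using ((h1.mul h2).mul_const x).norm
  refine (summable_of_ratio_norm_eventually_le (r := 1 / 2) (by norm_num) ?_)
  filter_upwards [hlim.eventually_le_const (show (0 : ℝ) < 1 / 2 by norm_num),
    eventually_add_natCast_ne_zero a, eventually_add_natCast_ne_zero b] with n hn ha hb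
  rw [norm_norm, norm_norm, Gamma_ratio_succ a b n ha hb]
  calc _ = ‖(a + n) / (b + n) * (1 / ((n : ℂ) + 1)) * x‖ *
        ‖Gamma (a + n) / ((n.factorial : ℂ) * Gamma (b + n)) * x ^ n‖ := by
        rw [← norm_mul]; congr 1; ring
    _ ≤ _ := by gcongr

lemma macE1_eq (a b z w : ℂ) (h : -1 / z = w) :
    macE1 a b z = ∑' n : ℕ, Gamma (a + n) / ((n.factorial : ℂ) * Gamma (b + n)) * w ^ n := by
  rw [macE1, h]

lemma macE2_succ_eq (a b c z : ℂ) (hc : 0 < c.re) :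
    macE2 a c b (c + 1) z =
      ∑' n : ℕ, Gamma (a + n) / ((n.factorial : ℂ) * Gamma (b + n)) * (-1 / z) ^ n / (c + n) := by
  refine tsum_congr fun n => ?_
  have hre : 0 < (c + n).re := by simpa using add_pos_of_pos_of_nonneg hc (Nat.cast_nonneg n)
  have h0 : c + n ≠ 0 := fun h => by simp [h] at hre
  have hG : Gamma (c + n) ≠ 0 := Gamma_ne_zero_of_re_pos hre
  rw [show c + 1 + (n : ℂ) = c + n + 1 by ring, Gamma_add_one _ h0]
  rw [show Gamma (a + n) * Gamma (c + n) / ((n.factorial : ℂ) * Gamma (b + n) *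
      ((c + n) * Gamma (c + n))) = Gamma (a + n) / ((n.factorial : ℂ) * Gamma (b + n)) / (c + n) *
      (Gamma (c + n) / Gamma (c + n)) by simp only [div_eq_mul_inv, mul_inv]; ring, div_self hG]
  ring

lemma setIntegral_Ioo_cpow (r : ℂ) (hr : -1 < r.re) {ρ : ℝ} (hρ : 0 < ρ) :
    ∫ t in Set.Ioo (0 : ℝ) ρ, (t : ℂ) ^ r = (ρ : ℂ) ^ (r + 1) / (r + 1) := by
  have h0 : r + 1 ≠ 0 := fun h => by
    have := congrArg re h
    simp at this
    linarith
  rw [← integral_Ioc_eq_integral_Ioo, ← intervalIntegral.integral_of_le hρ.le,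
    integral_cpow (Or.inl hr), ofReal_zero, zero_cpow h0, sub_zero]

lemma integrableOn_Ioo_cpow (r : ℂ) (hr : -1 < r.re) {ρ : ℝ} (hρ : 0 < ρ) :
    IntegrableOn (fun t : ℝ => (t : ℂ) ^ r) (Set.Ioo 0 ρ) :=
  ((intervalIntegrable_iff_integrableOn_Ioc_of_le hρ.le).1
    (intervalIntegral.intervalIntegrable_cpow' hr)).mono_set Set.Ioo_subset_Ioc_self

/-- Termwise integration of `t ^ β` times a product of two power series in `t`. -/
lemma integral_cpow_mul_tsum_mul_tsum (β : ℂ) (hre : -1 < β.re) {ρ : ℝ} (hρ : 0 < ρ)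
    (a b : ℕ → ℂ) (ha : Summable fun n => ‖a n * (ρ : ℂ) ^ n‖)
    (hb : Summable fun n => ‖b n * (ρ : ℂ) ^ n‖) :
    ∫ t in Set.Ioo (0 : ℝ) ρ,
        (t : ℂ) ^ β * (∑' n, a n * (t : ℂ) ^ n) * (∑' n, b n * (t : ℂ) ^ n) =
      (ρ : ℂ) ^ (β + 1) * ∑' p : ℕ × ℕ,
        b p.1 * (ρ : ℂ) ^ p.1 * (a p.2 * (ρ : ℂ) ^ p.2 / (β + 1 + p.1 + p.2)) := by
  set F : ℕ × ℕ → ℝ → ℂ := fun p t => b p.1 * a p.2 * (t : ℂ) ^ (β + p.1 + p.2) with hF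
  have hexp : ∀ p : ℕ × ℕ, -1 < (β + p.1 + p.2).re := fun p => by
    have h1 : (0 : ℝ) ≤ p.1 := Nat.cast_nonneg _
    have h2 : (0 : ℝ) ≤ p.2 := Nat.cast_nonneg _
    simp only [add_re, natCast_re]
    linarith
  have hsplit : ∀ (t : ℝ), 0 < t → ∀ (s : ℂ) (p : ℕ × ℕ),
      (t : ℂ) ^ (s + p.1 + p.2) = (t : ℂ) ^ s * (t : ℂ) ^ p.1 * (t : ℂ) ^ p.2 := by
    intro t ht s p
    have h0 : (t : ℂ) ≠ 0 := ofReal_ne_zero.2 ht.ne'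
    rw [cpow_add _ _ h0, cpow_add _ _ h0, cpow_natCast, cpow_natCast]
  have hint : ∀ p, Integrable (F p) (volume.restrict (Set.Ioo 0 ρ)) := fun p =>
    (integrableOn_Ioo_cpow _ (hexp p) hρ).const_mul _
  have hprod := hb.mul_of_nonneg ha (fun _ => norm_nonneg _) (fun _ => norm_nonneg _)
  have hsum : Summable fun p => ∫ t in Set.Ioo (0 : ℝ) ρ, ‖F p t‖ := by
    refine Summable.of_nonneg_of_le (fun p => integral_nonneg fun t => norm_nonneg _)
      (fun p => ?_) (hprod.mul_left (∫ t in Set.Ioo (0 : ℝ) ρ, ‖(t : ℂ) ^ β‖))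
    rw [← integral_mul_const]
    refine setIntegral_mono_on (hint p).norm
      ((integrableOn_Ioo_cpow _ hre hρ).norm.mul_const _) measurableSet_Ioo fun t ht => ?_
    simp only [hF]
    rw [hsplit t ht.1]
    simp only [norm_mul, norm_pow, norm_real, Real.norm_of_nonneg ht.1.le,
      Real.norm_of_nonneg hρ.le]
    have h1 : t ^ p.1 ≤ ρ ^ p.1 := pow_le_pow_left₀ ht.1.le ht.2.le _
    have h2 : t ^ p.2 ≤ ρ ^ p.2 := pow_le_pow_left₀ ht.1.le ht.2.le _
    have h3 : t ^ p.1 * t ^ p.2 ≤ ρ ^ p.1 * ρ ^ p.2 :=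
      mul_le_mul h1 h2 (pow_nonneg ht.1.le _) (pow_nonneg hρ.le _)
    calc _ = ‖(t : ℂ) ^ β‖ * ‖b p.1‖ * ‖a p.2‖ * (t ^ p.1 * t ^ p.2) := by ring
      _ ≤ ‖(t : ℂ) ^ β‖ * ‖b p.1‖ * ‖a p.2‖ * (ρ ^ p.1 * ρ ^ p.2) := by gcongr
      _ = _ := by ring
  have key := (hasSum_integral_of_summable_integral_norm hint hsum).tsum_eq
  have hL : ∫ t in Set.Ioo (0 : ℝ) ρ,
        (t : ℂ) ^ β * (∑' n, a n * (t : ℂ) ^ n) * (∑' n, b n * (t : ℂ) ^ n) =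
      ∫ t in Set.Ioo (0 : ℝ) ρ, ∑' p, F p t := by
    refine setIntegral_congr_fun measurableSet_Ioo fun t ht => ?_
    have hmono : ∀ c : ℕ → ℂ, (Summable fun n => ‖c n * (ρ : ℂ) ^ n‖) →
        Summable fun n => ‖c n * (t : ℂ) ^ n‖ := fun c hc => by
      refine Summable.of_nonneg_of_le (fun _ => norm_nonneg _) (fun n => ?_) hc
      simp only [norm_mul, norm_pow, norm_real, Real.norm_of_nonneg ht.1.le,
        Real.norm_of_nonneg hρ.le]
      exact mul_le_mul_of_nonneg_left (pow_le_pow_left₀ ht.1.le ht.2.le _) (norm_nonneg _)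
    have := tsum_mul_tsum_of_summable_norm (hmono b hb) (hmono a ha)
    simp only [hF]
    rw [mul_assoc, mul_comm (∑' n, a n * (t : ℂ) ^ n), this, ← tsum_mul_left]
    refine tsum_congr fun p => ?_
    rw [hsplit t ht.1]
    ring
  rw [hL, ← key, ← tsum_mul_left]
  refine tsum_congr fun p => ?_
  simp only [hF]
  rw [integral_const_mul, setIntegral_Ioo_cpow _ (hexp p) hρ,
    show β + p.1 + p.2 + 1 = β + 1 + p.1 + p.2 by ring, hsplit ρ hρ]
  ring

lemma summable_prod_div (β : ℂ) (hre : -1 < β.re) (u v : ℕ → ℂ)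
    (hu : Summable fun n => ‖u n‖) (hv : Summable fun n => ‖v n‖) :
    Summable fun p : ℕ × ℕ => u p.1 * (v p.2 / (β + 1 + p.1 + p.2)) := by
  have hpos : 0 < β.re + 1 := by linarith
  refine Summable.of_norm_bounded
    ((hu.mul_of_nonneg hv (fun _ => norm_nonneg _) (fun _ => norm_nonneg _)).div_const
      (β.re + 1)) fun p => ?_
  have hle : β.re + 1 ≤ ‖β + 1 + p.1 + p.2‖ := by
    refine le_trans ?_ (re_le_norm _)
    have h1 : (0 : ℝ) ≤ p.1 := Nat.cast_nonneg _
    have h2 : (0 : ℝ) ≤ p.2 := Nat.cast_nonneg _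
    simp only [add_re, natCast_re, one_re]
    linarith
  rw [norm_mul, norm_div, ← mul_div_assoc]
  gcongr

theorem stmt13 (α β γ : ℂ) (hre : -1 < β.re)
    (hβ : ∀ n : ℕ, β ≠ -(n : ℂ)) (hβ1 : ∀ n : ℕ, β + 1 ≠ -(n : ℂ))
    (hβ2 : ∀ n : ℕ, β + 2 ≠ -(n : ℂ))
    (ρ : ℝ) (hρ : 0 < ρ) :
    ∫ t in Set.Ioo (0 : ℝ) ρ,
        (t : ℂ) ^ β * macE1 α β (I / (t : ℂ)) * macE1 (α + γ) β (-I / (t : ℂ)) =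
      (ρ : ℂ) ^ (β + 1) *
        (β * fW (α - 1) (β + 1) (γ + 1) β (I / (ρ : ℂ)) -
          I * (ρ : ℂ) * fW (α - 1) (β + 2) (γ + 2) β (I / (ρ : ℂ))) := by
  have hzI : -1 / (I / (ρ : ℂ)) = I * ρ := by
    rw [div_div_eq_mul_div, div_I]; ring
  set A : ℕ → ℂ := fun n => Gamma (α + n) / ((n.factorial : ℂ) * Gamma (β + n)) with hA
  set B : ℕ → ℂ := fun n => Gamma (α + γ + n) / ((n.factorial : ℂ) * Gamma (β + n)) with hB
  set C : ℕ → ℂ := fun n => Gamma (α + γ + n) / ((n.factorial : ℂ) * Gamma (β + 1 + n)) with hC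
  set K : ℕ → ℂ := fun m => ∑' n : ℕ, A n * (I * ρ) ^ n / (β + 1 + m + n) with hK
  set x : ℂ := -I * ρ with hx
  have hAs : Summable fun n => ‖A n * (I * ρ) ^ n‖ := summable_norm_Gamma_ratio α β _
  have hBs : Summable fun n => ‖B n * x ^ n‖ := summable_norm_Gamma_ratio (α + γ) β _
  have hCs : Summable fun n => ‖C n * x ^ n‖ := summable_norm_Gamma_ratio (α + γ) (β + 1) _
  have hBC : ∀ m : ℕ, B m = (β + m) * C m := fun m => by
    have h0 : β + m ≠ 0 := fun h => hβ m (eq_neg_of_add_eq_zero_left h)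
    simp only [hB, hC]
    rw [show β + 1 + (m : ℂ) = β + m + 1 by ring, Gamma_add_one _ h0]
    field_simp
  have htsum : ∀ u : ℕ → ℂ, (Summable fun n => ‖u n‖) →
      HasSum (fun m => u m * K m)
        (∑' p : ℕ × ℕ, u p.1 * (A p.2 * (I * ρ) ^ p.2 / (β + 1 + p.1 + p.2))) := fun u hu => by
    have hs := summable_prod_div β hre u _ hu hAs
    have := hs.hasSum.prod_fiberwise fun m => (hs.prod_factor m).hasSum
    simpa only [hK, tsum_mul_left] using this
  have hintegral : ∫ t in Set.Ioo (0 : ℝ) ρ,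
        (t : ℂ) ^ β * macE1 α β (I / (t : ℂ)) * macE1 (α + γ) β (-I / (t : ℂ)) =
      (ρ : ℂ) ^ (β + 1) * ∑' m, B m * x ^ m * K m := by
    rw [(htsum _ hBs).tsum_eq]
    have h := integral_cpow_mul_tsum_mul_tsum β hre hρ (fun n => A n * I ^ n)
      (fun n => B n * (-I) ^ n) (by simpa only [mul_pow, mul_assoc] using hAs)
      (by simpa only [hx, mul_pow, mul_assoc] using hBs)
    convert h using 1
    · refine setIntegral_congr_fun measurableSet_Ioo fun t ht => ?_
      have hz1 : -1 / (I / (t : ℂ)) = I * t := by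
        rw [div_div_eq_mul_div, div_I]; ring
      have hz2 : -1 / (-I / (t : ℂ)) = -I * t := by
        rw [div_div_eq_mul_div, div_neg, div_I]; ring
      simp only [macE1_eq _ _ _ _ hz1, macE1_eq _ _ _ _ hz2, hA, hB, mul_pow, mul_assoc]
    · simp only [hx, mul_pow, mul_assoc]
  have hzpow : ∀ m : ℕ, (I / (ρ : ℂ)) ^ (-(m : ℤ)) = x ^ m := fun m => by
    rw [zpow_neg, zpow_natCast, ← inv_pow, inv_div, div_I]
    congr 1
    rw [hx]; ring
  have hE : ∀ c : ℂ, 0 < c.re → macE2 α c β (c + 1) (I / (ρ : ℂ)) =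
      ∑' n : ℕ, A n * (I * ρ) ^ n / (c + n) := fun c hc => by
    rw [macE2_succ_eq _ _ _ _ hc, hzI]
  have hcre : ∀ m : ℕ, 0 < (β + 1 + m).re := fun m => by
    have h1 : (0 : ℝ) ≤ m := Nat.cast_nonneg _
    simp only [add_re, natCast_re, one_re]
    linarith
  have hf1 : fW (α - 1) (β + 1) (γ + 1) β (I / (ρ : ℂ)) = ∑' m, C m * x ^ m * K m := by
    refine tsum_congr fun m => ?_
    rw [hzpow, sub_add_cancel, show β + 1 + 1 + (m : ℂ) = β + 1 + m + 1 by ring, hE _ (hcre m),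
      show α - 1 + (γ + 1) + (m : ℂ) = α + γ + m by ring]
    simp only [hC, hK]
    ring
  have hCK := (htsum _ hCs).summable
  have hmCK : Summable fun m : ℕ => (m : ℂ) * (C m * x ^ m * K m) := by
    have h : (fun m : ℕ => (m : ℂ) * (C m * x ^ m * K m)) =
        fun m => B m * x ^ m * K m - β * (C m * x ^ m * K m) := by
      funext m
      rw [hBC]; ring
    rw [h]
    exact (htsum _ hBs).summable.sub (hCK.mul_left β)
  have hf2 : -I * ρ * fW (α - 1) (β + 2) (γ + 2) β (I / (ρ : ℂ)) =
      ∑' m : ℕ, (m : ℂ) * (C m * x ^ m * K m) := by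
    have hsucc : ∀ m : ℕ, ((m + 1 : ℕ) : ℂ) * (C (m + 1) * x ^ (m + 1) * K (m + 1)) =
        -I * ρ * ((I / (ρ : ℂ)) ^ (-(m : ℤ)) * Gamma (α - 1 + (γ + 2) + m) /
          ((m.factorial : ℂ) * Gamma (β + 2 + m)) *
          macE2 (α - 1 + 1) (β + 2 + m) β (β + 2 + 1 + m) (I / (ρ : ℂ))) := fun m => by
      have hm : (m : ℂ) + 1 ≠ 0 := Nat.cast_add_one_ne_zero m
      have hc : β + 2 + (m : ℂ) = β + 1 + (m + 1 : ℕ) := by push_cast; ring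
      rw [hzpow, sub_add_cancel, show β + 2 + 1 + (m : ℂ) = β + 2 + m + 1 by ring, hc,
        hE _ (hcre (m + 1)),
        show α - 1 + (γ + 2) + (m : ℂ) = α + γ + (m + 1 : ℕ) by push_cast; ring]
      simp only [hC, hK, Nat.factorial_succ, pow_succ, ← hx]
      rw [Nat.cast_mul, show ((m + 1 : ℕ) : ℂ) = m + 1 by push_cast; ring]
      field_simp
    rw [fW, ← tsum_mul_left, ← tsum_congr hsucc]
    rw [hmCK.tsum_eq_zero_add]
    simp
  rw [hintegral, sub_eq_add_neg, ← neg_mul, ← neg_mul, hf2, hf1,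
    ← hCK.tsum_mul_left, ← (hCK.mul_left β).tsum_add hmCK]
  congr 1
  refine tsum_congr fun m => ?_
  rw [hBC]; ring
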